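/- Let n ≥ 1, d = 2ⁿ, and let Q = d⁻² Σ_{P ∈ 𝒫ₙ} P^{⊗4} be the operator on (ℂ^d)^{⊗4} built from the fourth tensor powers of all n-qubit Pauli strings. Then the sum over all 24 permutations of four objects of the traces of Q against the permutation operators equals Σ_{π ∈ S₄} tr(Q T_π) = 4d² + 12d + 8; consequently, for any unit vector ψ ∈ ℂ^d, the Haar average satisfies ∫_{U(d)} tr( Q (Uψψ†U†)^{⊗4} ) dμ(U) = (4d² + 12d + 8) / ( d(d+1)(d+2)(d+3) ). -/

import Mathlib

open Matrix MeasureTheory BigOperators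

noncomputable section

attribute [local instance] Matrix.normedAddCommGroup Matrix.normedSpace

/-- Borel measurable structure on the unitary group `U(ι)`. -/
instance (ι : Type*) [Fintype ι] [DecidableEq ι] :
    MeasurableSpace (Matrix.unitaryGroup ι ℂ) := borel _

instance (ι : Type*) [Fintype ι] [DecidableEq ι] :
    BorelSpace (Matrix.unitaryGroup ι ℂ) := ⟨rfl⟩

/-- The pure state (rank-one orthogonal projector) `|v⟩⟨v| = v v†` associated to a vector. -/
def pureState {ι : Type*} (v : ι → ℂ) : Matrix ι ι ℂ :=
  Matrix.vecMulVec v (star v)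

/-- The `k`-fold tensor (Kronecker) power `A^{⊗k}` of a matrix, acting on
`(ℂ^ι)^{⊗k}` realized as functions `(Fin k → ι) → ℂ`. -/
def kronPow {ι : Type*} (k : ℕ) (A : Matrix ι ι ℂ) :
    Matrix (Fin k → ι) (Fin k → ι) ℂ :=
  Matrix.of fun r c => ∏ i, A (r i) (c i)

/-- The permutation operator `T_π` on `(ℂ^ι)^{⊗k}`, permuting tensor factors:
its matrix entries are `T_π(f, g) = 1` if `f = g ∘ π⁻¹` and `0` otherwise. -/
def permOp {ι : Type*} [DecidableEq ι] (k : ℕ) (π : Equiv.Perm (Fin k)) :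
    Matrix (Fin k → ι) (Fin k → ι) ℂ :=
  Matrix.of fun r c => if r = c ∘ ⇑π⁻¹ then 1 else 0

/-- The four 2×2 Pauli matrices: σ₀ = I, σ₁ = X, σ₂ = Y, σ₃ = Z. -/
def pauli : Fin 4 → Matrix (Fin 2) (Fin 2) ℂ
  | 0 => 1
  | 1 => !![0, 1; 1, 0]
  | 2 => !![0, -Complex.I; Complex.I, 0]
  | 3 => !![1, 0; 0, -1]

/-- Pauli string `σ_{f(1)} ⊗ ⋯ ⊗ σ_{f(n)}` on `n` qubits. -/
def pauliString {n : ℕ} (f : Fin n → Fin 4) :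
    Matrix (Fin n → Fin 2) (Fin n → Fin 2) ℂ :=
  Matrix.of fun r c => ∏ k, pauli (f k) (r k) (c k)

/-- The operator `Q = d⁻² Σ_{P ∈ 𝒫ₙ} P^{⊗4}` on `(ℂ^d)^{⊗4}`, `d = 2ⁿ`. -/
def Qop (n : ℕ) : Matrix (Fin 4 → (Fin n → Fin 2)) (Fin 4 → (Fin n → Fin 2)) ℂ :=
  (((2 : ℂ) ^ n) ^ 2)⁻¹ • ∑ f : Fin n → Fin 4, kronPow 4 (pauliString f)

/-- Integer versions of the Pauli matrices, with `Y` replaced by `iY`. -/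
def pauliInt : Fin 4 → Matrix (Fin 2) (Fin 2) ℤ
  | 0 => 1
  | 1 => !![0, 1; 1, 0]
  | 2 => !![0, 1; -1, 0]
  | 3 => !![1, 0; 0, -1]

lemma prod_pauli_eq_prod_pauliInt (s : Fin 4) (a b : Fin 4 → Fin 2) :
    ∏ i, pauli s (a i) (b i) = ((∏ i, pauliInt s (a i) (b i) : ℤ) : ℂ) := by
  have key : ∃ z : ℂ, z ^ 4 = 1 ∧ ∀ x y, pauli s x y = z * (pauliInt s x y : ℂ) := by
    fin_cases s
    · exact ⟨1, by simp, fun x y => by fin_cases x <;> fin_cases y <;> simp [pauli, pauliInt]⟩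
    · exact ⟨1, by simp, fun x y => by fin_cases x <;> fin_cases y <;> simp [pauli, pauliInt]⟩
    · exact ⟨-Complex.I, by linear_combination (Complex.I ^ 2 - 1) * Complex.I_sq, fun x y => by
        fin_cases x <;> fin_cases y <;> simp [pauli, pauliInt]⟩
    · exact ⟨1, by simp, fun x y => by fin_cases x <;> fin_cases y <;> simp [pauli, pauliInt]⟩
  obtain ⟨z, hz, h⟩ := key
  simp [h, Finset.prod_mul_distrib, hz]

/-- The single-qubit value of `∑ σ, tr (σ^{⊗4} T_{π⁻¹})`, as an integer. -/
def pauliCycleSum (π : Equiv.Perm (Fin 4)) : ℤ :=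
  ∑ s : Fin 4, ∑ r : Fin 4 → Fin 2, ∏ i, pauliInt s (r i) (r (π i))

lemma image_pauliCycleSum :
    (Finset.univ : Finset (Equiv.Perm (Fin 4))).image pauliCycleSum = {4, 8, 16} := by
  decide +kernel

lemma card_pauliCycleSum_eq_four :
    (Finset.univ.filter fun π : Equiv.Perm (Fin 4) => pauliCycleSum π = 4).card = 8 := by
  decide +kernel

lemma card_pauliCycleSum_eq_eight :
    (Finset.univ.filter fun π : Equiv.Perm (Fin 4) => pauliCycleSum π = 8).card = 12 := by
  decide +kernel

lemma card_pauliCycleSum_eq_sixteen :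
    (Finset.univ.filter fun π : Equiv.Perm (Fin 4) => pauliCycleSum π = 16).card = 4 := by
  decide +kernel

lemma sum_pauliCycleSum_pow (n : ℕ) :
    ∑ π : Equiv.Perm (Fin 4), (pauliCycleSum π : ℂ) ^ n = 8 * 4 ^ n + 12 * 8 ^ n + 4 * 16 ^ n := by
  rw [Finset.sum_comp (fun z : ℤ => (z : ℂ) ^ n) pauliCycleSum, image_pauliCycleSum]
  rw [Finset.sum_insert (by decide), Finset.sum_insert (by decide), Finset.sum_singleton,
    card_pauliCycleSum_eq_four, card_pauliCycleSum_eq_eight, card_pauliCycleSum_eq_sixteen]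
  simp only [nsmul_eq_mul]
  push_cast
  ring

lemma prod_sum_eq_sum_pi {ι κ R : Type*} [Fintype ι] [DecidableEq ι] [Fintype κ] [CommSemiring R]
    (F : ι → κ → R) : ∏ i, ∑ j, F i j = ∑ f : ι → κ, ∏ i, F i (f i) := by
  rw [Finset.prod_univ_sum, Fintype.piFinset_univ]

lemma trace_kronPow_pauliString_mul_permOp {n : ℕ} (f : Fin n → Fin 4)
    (π : Equiv.Perm (Fin 4)) :
    (kronPow 4 (pauliString f) * permOp 4 π).trace =
      ∏ k, ∑ t : Fin 4 → Fin 2, ∏ i, pauli (f k) (t i) (t (π⁻¹ i)) := by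
  rw [prod_sum_eq_sum_pi]
  simp only [Matrix.trace, Matrix.diag_apply, Matrix.mul_apply, kronPow, permOp, Matrix.of_apply,
    pauliString, mul_ite, mul_one, mul_zero, Finset.sum_ite_eq', Finset.mem_univ, if_true]
  refine Fintype.sum_equiv (Equiv.piComm fun _ _ => Fin 2) _ _ fun r => ?_
  rw [Finset.prod_comm]
  rfl

lemma sum_trace_kronPow_pauliString_mul_permOp (n : ℕ) (π : Equiv.Perm (Fin 4)) :
    ∑ f : Fin n → Fin 4, (kronPow 4 (pauliString f) * permOp 4 π).trace =
      (pauliCycleSum π⁻¹ : ℂ) ^ n := by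
  simp only [trace_kronPow_pauliString_mul_permOp]
  rw [← prod_sum_eq_sum_pi fun (_ : Fin n) (s : Fin 4) =>
    ∑ t : Fin 4 → Fin 2, ∏ i, pauli s (t i) (t (π⁻¹ i))]
  have h (s : Fin 4) (t : Fin 4 → Fin 2) := prod_pauli_eq_prod_pauliInt s t fun i => t (π⁻¹ i)
  simp only [h, Finset.prod_const, Finset.card_univ, Fintype.card_fin, pauliCycleSum]
  push_cast
  rfl

lemma sum_trace_Qop_mul_permOp (n : ℕ) :
    ∑ π : Equiv.Perm (Fin 4), (Qop n * permOp 4 π).trace =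
      4 * ((2 : ℂ) ^ n) ^ 2 + 12 * ((2 : ℂ) ^ n) + 8 := by
  have h (π : Equiv.Perm (Fin 4)) : (Qop n * permOp 4 π).trace =
      (((2 : ℂ) ^ n) ^ 2)⁻¹ * (pauliCycleSum π⁻¹ : ℂ) ^ n := by
    rw [Qop, Matrix.smul_mul, Matrix.trace_smul, Matrix.sum_mul, Matrix.trace_sum,
      sum_trace_kronPow_pauliString_mul_permOp, smul_eq_mul]
  simp only [h, ← Finset.mul_sum]
  rw [Fintype.sum_equiv (Equiv.inv _) (fun π : Equiv.Perm (Fin 4) => (pauliCycleSum π⁻¹ : ℂ) ^ n)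
    (fun π => (pauliCycleSum π : ℂ) ^ n) fun π => rfl, sum_pauliCycleSum_pow]
  have h4 : (4 : ℂ) ^ n = (2 ^ n) ^ 2 := by rw [← pow_mul, mul_comm, pow_mul]; norm_num
  have h8 : (8 : ℂ) ^ n = (2 ^ n) ^ 3 := by rw [← pow_mul, mul_comm, pow_mul]; norm_num
  have h16 : (16 : ℂ) ^ n = (2 ^ n) ^ 4 := by rw [← pow_mul, mul_comm, pow_mul]; norm_num
  rw [h4, h8, h16]
  have : (2 : ℂ) ^ n ≠ 0 := pow_ne_zero _ two_ne_zero
  field_simp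
  ring

lemma trace_kronPow_mul_kronPow {ι : Type*} [Fintype ι] (k : ℕ) (A B : Matrix ι ι ℂ) :
    (kronPow k A * kronPow k B).trace = (A * B).trace ^ k := by
  classical
  have h : (A * B).trace ^ k = ∏ _i : Fin k, ∑ p : ι × ι, A p.1 p.2 * B p.2 p.1 := by
    simp [Matrix.trace, Matrix.mul_apply, Fintype.sum_prod_type]
  rw [h, prod_sum_eq_sum_pi]
  simp only [Matrix.trace, Matrix.diag_apply, Matrix.mul_apply, kronPow, Matrix.of_apply,
    ← Finset.prod_mul_distrib]
  rw [← Fintype.sum_prod_type']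
  exact (Fintype.sum_equiv (Equiv.arrowProdEquivProdArrow (Fin k) (fun _ => ι) (fun _ => ι)) _ _
    fun _ => rfl).symm

/-- The commutation sign of two single-qubit Pauli matrices. -/
def pauliSign (s t : Fin 4) : ℂ := if s = 0 ∨ t = 0 ∨ s = t then 1 else -1

lemma pauli_conjTranspose (s : Fin 4) : (pauli s)ᴴ = pauli s := by
  fin_cases s <;> ext i j <;> fin_cases i <;> fin_cases j <;> simp [pauli]

lemma pauli_mul_self (s : Fin 4) : pauli s * pauli s = 1 := by
  fin_cases s <;> ext i j <;> fin_cases i <;> fin_cases j <;> simp [pauli]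

lemma pauli_mul_mul (s t : Fin 4) : pauli s * pauli t * pauli s = pauliSign s t • pauli t := by
  fin_cases s <;> fin_cases t <;> ext i j <;> fin_cases i <;> fin_cases j <;>
    simp [pauli, pauliSign]

lemma sum_pauliSign {s : Fin 4} (hs : s ≠ 0) : ∑ t, pauliSign s t = 0 := by
  fin_cases s <;> simp [pauliSign, Fin.sum_univ_four] at hs ⊢

lemma sum_pauli_mul_pauli (a b c d : Fin 2) :
    ∑ s, pauli s a b * pauli s c d = if a = d ∧ b = c then 2 else 0 := by
  fin_cases a <;> fin_cases b <;> fin_cases c <;> fin_cases d <;>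
    simp [pauli, Fin.sum_univ_four] <;> norm_num

/-- The commutation sign of two Pauli strings. -/
def pauliStringSign {n : ℕ} (f g : Fin n → Fin 4) : ℂ := ∏ k, pauliSign (f k) (g k)

lemma pauliString_conjTranspose {n : ℕ} (f : Fin n → Fin 4) :
    (pauliString f)ᴴ = pauliString f := by
  ext r c
  have h (k : Fin n) := congrFun₂ (pauli_conjTranspose (f k)) (r k) (c k)
  simp only [Matrix.conjTranspose_apply] at h
  simp [pauliString, h]

/-- Product of local matrices, as a matrix on the tensor product. -/
def piMatrix {n : ℕ} (A : Fin n → Matrix (Fin 2) (Fin 2) ℂ) :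
    Matrix (Fin n → Fin 2) (Fin n → Fin 2) ℂ :=
  Matrix.of fun r c => ∏ k, A k (r k) (c k)

lemma piMatrix_mul {n : ℕ} (A B : Fin n → Matrix (Fin 2) (Fin 2) ℂ) :
    piMatrix A * piMatrix B = piMatrix fun k => A k * B k := by
  ext r c
  simp only [piMatrix, Matrix.mul_apply, Matrix.of_apply, prod_sum_eq_sum_pi,
    Finset.prod_mul_distrib]

lemma pauliString_eq_piMatrix {n : ℕ} (f : Fin n → Fin 4) :
    pauliString f = piMatrix fun k => pauli (f k) := rfl

lemma piMatrix_one {n : ℕ} : piMatrix (fun _ : Fin n => 1) = 1 := by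
  ext r c
  by_cases h : r = c
  · subst h
    simp [piMatrix, Matrix.one_apply_eq]
  · obtain ⟨k, hk⟩ := Function.ne_iff.mp h
    rw [Matrix.one_apply_ne h]
    exact Finset.prod_eq_zero (Finset.mem_univ k) (Matrix.one_apply_ne hk)

lemma pauliString_mul_self {n : ℕ} (f : Fin n → Fin 4) : pauliString f * pauliString f = 1 := by
  simp only [pauliString_eq_piMatrix, piMatrix_mul, pauli_mul_self, piMatrix_one]

lemma pauliString_mul_mul {n : ℕ} (f g : Fin n → Fin 4) :
    pauliString f * pauliString g * pauliString f = pauliStringSign f g • pauliString g := by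
  simp only [pauliString_eq_piMatrix, piMatrix_mul, pauli_mul_mul]
  ext r c
  simp [piMatrix, pauliStringSign, Finset.prod_mul_distrib]

lemma pauliString_zero {n : ℕ} : pauliString (0 : Fin n → Fin 4) = 1 := piMatrix_one

lemma pauliStringSign_eq {n : ℕ} (f g : Fin n → Fin 4) :
    pauliStringSign f g = 1 ∨ pauliStringSign f g = -1 := by
  rw [← sq_eq_one_iff, pauliStringSign, ← Finset.prod_pow]
  refine Finset.prod_eq_one fun k _ => ?_
  rw [pauliSign]
  split_ifs <;> norm_num

lemma sum_pauliStringSign {n : ℕ} {f : Fin n → Fin 4} (hf : f ≠ 0) :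
    ∑ g, pauliStringSign f g = 0 := by
  obtain ⟨k, hk⟩ := Function.ne_iff.mp hf
  simp only [pauliStringSign]
  rw [← prod_sum_eq_sum_pi fun k t => pauliSign (f k) t]
  exact Finset.prod_eq_zero (Finset.mem_univ k) (sum_pauliSign hk)

lemma sum_pauliString_mul_pauliString {n : ℕ} (a b c d : Fin n → Fin 2) :
    ∑ f, pauliString f a b * pauliString f c d = if a = d ∧ b = c then 2 ^ n else 0 := by
  simp only [pauliString, Matrix.of_apply, ← Finset.prod_mul_distrib]
  rw [← prod_sum_eq_sum_pi fun k s => pauli s (a k) (b k) * pauli s (c k) (d k)]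
  simp only [sum_pauli_mul_pauli]
  split_ifs with h
  · obtain ⟨rfl, rfl⟩ := h
    simp
  · have : ∃ k, ¬(a k = d k ∧ b k = c k) := by
      by_contra! hc
      exact h ⟨funext fun k => (hc k).1, funext fun k => (hc k).2⟩
    obtain ⟨k, hk⟩ := this
    exact Finset.prod_eq_zero (Finset.mem_univ k) (if_neg hk)

lemma sum_trace_pauliString_mul_trace {n : ℕ} (A B : Matrix (Fin n → Fin 2) (Fin n → Fin 2) ℂ) :
    ∑ f, (pauliString f * A).trace * (pauliString f * B).trace = 2 ^ n * (A * B).trace := by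
  have h (f : Fin n → Fin 4) : (pauliString f * A).trace * (pauliString f * B).trace =
      ∑ a, ∑ b, ∑ c, ∑ d, A b a * B d c * (pauliString f a b * pauliString f c d) := by
    simp only [Matrix.trace, Matrix.diag_apply, Matrix.mul_apply]
    rw [Finset.sum_mul]
    refine Finset.sum_congr rfl fun a _ => ?_
    rw [Finset.sum_mul]
    refine Finset.sum_congr rfl fun b _ => ?_
    rw [Finset.mul_sum]
    refine Finset.sum_congr rfl fun c _ => ?_
    rw [Finset.mul_sum]
    refine Finset.sum_congr rfl fun d _ => ?_
    ring
  calc ∑ f, (pauliString f * A).trace * (pauliString f * B).trace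
      = ∑ a, ∑ b, ∑ c, ∑ d, A b a * B d c *
          ∑ f : Fin n → Fin 4, pauliString f a b * pauliString f c d := by
        simp only [h, Finset.mul_sum]
        rw [Finset.sum_comm]
        refine Finset.sum_congr rfl fun a _ => ?_
        rw [Finset.sum_comm]
        refine Finset.sum_congr rfl fun b _ => ?_
        rw [Finset.sum_comm]
        refine Finset.sum_congr rfl fun c _ => ?_
        rw [Finset.sum_comm]
    _ = ∑ a, ∑ b, 2 ^ n * (A b a * B a b) := by
        refine Finset.sum_congr rfl fun a _ => Finset.sum_congr rfl fun b _ => ?_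
        rw [Finset.sum_eq_single b, Finset.sum_eq_single a]
        · rw [sum_pauliString_mul_pauliString, if_pos ⟨rfl, rfl⟩]
          ring
        · intro d _ hd
          rw [sum_pauliString_mul_pauliString, if_neg fun h => hd h.1.symm, mul_zero]
        · simp
        · intro c _ hc
          refine Finset.sum_eq_zero fun d _ => ?_
          rw [sum_pauliString_mul_pauliString, if_neg fun h => hc h.2.symm, mul_zero]
        · simp
    _ = 2 ^ n * (A * B).trace := by
        rw [Finset.sum_comm]
        simp only [Matrix.trace, Matrix.diag_apply, Matrix.mul_apply, Finset.mul_sum]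

lemma sum_trace_pauliString_sq {n : ℕ} {φ : (Fin n → Fin 2) → ℂ} (hφ : star φ ⬝ᵥ φ = 1) :
    ∑ f, (pauliString f * pureState φ).trace ^ 2 = 2 ^ n := by
  simp only [sq, sum_trace_pauliString_mul_trace]
  simp [pureState, Matrix.vecMulVec_mul_vecMulVec, Matrix.trace_vecMulVec, hφ, dotProduct_comm φ]

lemma sum_pauliStringSign_mul_trace_sq {n : ℕ} (φ : (Fin n → Fin 2) → ℂ) (f : Fin n → Fin 4) :
    ∑ g, pauliStringSign f g * (pauliString g * pureState φ).trace ^ 2 =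
      2 ^ n * (pauliString f * pureState φ).trace ^ 2 := by
  have h (g : Fin n → Fin 4) : pauliStringSign f g * (pauliString g * pureState φ).trace ^ 2 =
      (pauliString g * pureState φ).trace *
        (pauliString g * (pauliString f * pureState φ * pauliString f)).trace := by
    have := congrArg (fun M => (M * pureState φ).trace) (pauliString_mul_mul f g)
    simp only [Matrix.smul_mul, Matrix.trace_smul, smul_eq_mul] at this
    rw [sq, mul_left_comm, ← this, Matrix.mul_assoc (pauliString f), Matrix.mul_assoc,
      Matrix.trace_mul_comm (pauliString f), Matrix.mul_assoc, Matrix.mul_assoc, Matrix.mul_assoc]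
  simp only [h, sum_trace_pauliString_mul_trace]
  congr 1
  have hdot : star φ ᵥ* pauliString f ⬝ᵥ φ = pauliString f *ᵥ φ ⬝ᵥ star φ := by
    rw [← Matrix.dotProduct_mulVec, dotProduct_comm]
  simp [pureState, Matrix.mul_vecMulVec, Matrix.vecMulVec_mul, Matrix.trace_vecMulVec,
    Matrix.vecMulVec_mulVec, hdot, dotProduct_comm φ, sq]

section Expectation

variable {ι : Type*} [Fintype ι] [DecidableEq ι]

instance : CompactSpace (Matrix.unitaryGroup ι ℂ) := by
  have : ProperSpace (Matrix ι ι ℂ) := FiniteDimensional.proper ℂ _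
  refine isCompact_iff_compactSpace.mp (Metric.isCompact_of_isClosed_isBounded ?_ ?_)
  · exact @isClosed_unitary (Matrix ι ι ℂ) _ _ instTopologicalSpaceMatrix _ _ _
  · refine (Metric.isBounded_closedBall (x := (0 : Matrix ι ι ℂ)) (r := 1)).subset fun U hU => ?_
    rw [mem_closedBall_zero_iff, Matrix.norm_le_iff zero_le_one]
    exact fun i j => entry_norm_bound_of_unitary hU i j

/-- The expectation value of the observable `A` in the state `U ψ`. -/
def expect (ψ : ι → ℂ) (A : Matrix ι ι ℂ) (U : Matrix.unitaryGroup ι ℂ) : ℂ :=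
  (A * pureState ((U : Matrix ι ι ℂ) *ᵥ ψ)).trace

lemma continuous_expect (ψ : ι → ℂ) (A : Matrix ι ι ℂ) : Continuous (expect ψ A) := by
  unfold expect pureState
  have h : Continuous fun U : Matrix.unitaryGroup ι ℂ => (U : Matrix ι ι ℂ) *ᵥ ψ :=
    continuous_subtype_val.matrix_mulVec continuous_const
  exact (continuous_const.matrix_mul (h.matrix_vecMulVec h.star)).matrix_trace

lemma expect_add (ψ : ι → ℂ) (A B : Matrix ι ι ℂ) (U : Matrix.unitaryGroup ι ℂ) :
    expect ψ (A + B) U = expect ψ A U + expect ψ B U := by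
  simp [expect, Matrix.add_mul]

lemma expect_smul (ψ : ι → ℂ) (c : ℂ) (A : Matrix ι ι ℂ) (U : Matrix.unitaryGroup ι ℂ) :
    expect ψ (c • A) U = c * expect ψ A U := by
  simp [expect]

lemma expect_unitary_mul (ψ : ι → ℂ) (A : Matrix ι ι ℂ) (V U : Matrix.unitaryGroup ι ℂ) :
    expect ψ A (V * U) = expect ψ ((V : Matrix ι ι ℂ)ᴴ * A * V) U := by
  have h : pureState (((V * U : Matrix.unitaryGroup ι ℂ) : Matrix ι ι ℂ) *ᵥ ψ) =
      V * pureState ((U : Matrix ι ι ℂ) *ᵥ ψ) * (V : Matrix ι ι ℂ)ᴴ := by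
    simp [pureState, Matrix.mul_vecMulVec, Matrix.vecMulVec_mul, Matrix.star_mulVec,
      ← Matrix.mulVec_mulVec]
  rw [expect, expect, h, ← Matrix.mul_assoc, Matrix.trace_mul_comm, ← Matrix.mul_assoc,
    ← Matrix.mul_assoc]

lemma star_unitary_mulVec_dotProduct {ψ : ι → ℂ} (hψ : star ψ ⬝ᵥ ψ = 1)
    (U : Matrix.unitaryGroup ι ℂ) :
    star ((U : Matrix ι ι ℂ) *ᵥ ψ) ⬝ᵥ ((U : Matrix ι ι ℂ) *ᵥ ψ) = 1 := by
  have h : (U : Matrix ι ι ℂ)ᴴ * U = 1 := Matrix.UnitaryGroup.star_mul_self U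
  rw [Matrix.star_mulVec, Matrix.dotProduct_mulVec, Matrix.vecMul_vecMul, h, Matrix.vecMul_one, hψ]

lemma expect_one {ψ : ι → ℂ} (hψ : star ψ ⬝ᵥ ψ = 1) (U : Matrix.unitaryGroup ι ℂ) :
    expect ψ 1 U = 1 := by
  rw [expect, Matrix.one_mul, pureState, Matrix.trace_vecMulVec, dotProduct_comm,
    star_unitary_mulVec_dotProduct hψ]

variable (μ : Measure (Matrix.unitaryGroup ι ℂ)) [μ.IsHaarMeasure]

lemma integrable_of_continuous_unitaryGroup {f : Matrix.unitaryGroup ι ℂ → ℂ}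
    (hf : Continuous f) : Integrable f μ :=
  hf.integrable_of_hasCompactSupport (HasCompactSupport.of_compactSpace f)

lemma integral_expect_rotation (ψ : ι → ℂ) {P C : Matrix ι ι ℂ} (hP : Pᴴ = P) (hC : Cᴴ = C)
    (hPP : P * P = 1) (hCC : C * C = 1) (hCP : C * P = -(P * C)) (m : ℕ) :
    ∫ U, (7 * expect ψ P U + 24 * expect ψ C U) ^ m ∂μ = ∫ U, (-25 * expect ψ P U) ^ m ∂μ := by
  have hPCP : P * C * P = -C := by rw [Matrix.mul_assoc, hCP, Matrix.mul_neg, ← Matrix.mul_assoc,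
    hPP, Matrix.one_mul]
  have hCPC : P * C * P * C = -1 := by rw [hPCP, Matrix.neg_mul, hCC]
  set W : Matrix ι ι ℂ := (3 / 5 : ℂ) • 1 - (4 / 5 : ℂ) • (P * C) with hW
  have hWs : Wᴴ = (3 / 5 : ℂ) • 1 + (4 / 5 : ℂ) • (P * C) := by
    simp [hW, Matrix.conjTranspose_mul, hP, hC, hCP]
  have hunit : Wᴴ * W = 1 := by
    rw [hWs, hW]
    simp only [Matrix.add_mul, Matrix.mul_sub, Matrix.smul_mul, Matrix.mul_smul, Matrix.one_mul,
      Matrix.mul_one, ← Matrix.mul_assoc, hCPC]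
    module
  have hconj : Wᴴ * P * W = (-7 / 25 : ℂ) • P + (-24 / 25 : ℂ) • C := by
    have h1 : P * P * C = C := by rw [hPP, Matrix.one_mul]
    have h2 : C * P * C = -P := by rw [hCP, Matrix.neg_mul, Matrix.mul_assoc, hCC, Matrix.mul_one]
    rw [hWs, hW]
    simp only [Matrix.add_mul, Matrix.mul_sub, Matrix.smul_mul, Matrix.mul_smul, Matrix.one_mul,
      Matrix.mul_one, ← Matrix.mul_assoc, hPCP, h1, h2, Matrix.neg_mul]
    module
  let V : Matrix.unitaryGroup ι ℂ := ⟨W, Matrix.mem_unitaryGroup_iff'.mpr hunit⟩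
  rw [← integral_mul_left_eq_self (fun U => (-25 * expect ψ P U) ^ m) V]
  congr 1
  funext U
  rw [expect_unitary_mul, show (V : Matrix ι ι ℂ) = W from rfl, hconj, expect_add, expect_smul,
    expect_smul]
  ring

/-- Averaging `integral_expect_rotation` over the two signs of `C`. -/
lemma integral_expect_rotation_add (ψ : ι → ℂ) {P C : Matrix ι ι ℂ} (hP : Pᴴ = P) (hC : Cᴴ = C)
    (hPP : P * P = 1) (hCC : C * C = 1) (hCP : C * P = -(P * C)) (m : ℕ) :
    ∫ U, ((7 * expect ψ P U + 24 * expect ψ C U) ^ m +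
      (7 * expect ψ P U - 24 * expect ψ C U) ^ m) ∂μ = 2 * ∫ U, (-25 * expect ψ P U) ^ m ∂μ := by
  have hneg (U : Matrix.unitaryGroup ι ℂ) : expect ψ (-C) U = -expect ψ C U := by simp [expect]
  have h := integral_expect_rotation μ ψ hP (C := -C) (by simp [hC]) hPP (by simp [hCC])
    (by simp [hCP]) m
  simp only [hneg, mul_neg, ← sub_eq_add_neg] at h
  have cP := continuous_expect ψ P
  have cC := continuous_expect ψ C
  rw [integral_add (integrable_of_continuous_unitaryGroup μ (by fun_prop))
    (integrable_of_continuous_unitaryGroup μ (by fun_prop)),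
    integral_expect_rotation μ ψ hP hC hPP hCC hCP, h]
  ring

lemma integral_expect_sq_of_anticommute (ψ : ι → ℂ) {P C : Matrix ι ι ℂ} (hP : Pᴴ = P)
    (hC : Cᴴ = C) (hPP : P * P = 1) (hCC : C * C = 1) (hCP : C * P = -(P * C)) :
    ∫ U, expect ψ C U ^ 2 ∂μ = ∫ U, expect ψ P U ^ 2 ∂μ := by
  have cP := continuous_expect ψ P
  have cC := continuous_expect ψ C
  have h := integral_expect_rotation_add μ ψ hP hC hPP hCC hCP 2
  have hpt (p c : ℂ) : (7 * p + 24 * c) ^ 2 + (7 * p - 24 * c) ^ 2 = 98 * p ^ 2 + 1152 * c ^ 2 := by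
    ring
  simp only [hpt, mul_pow] at h
  rw [integral_add (integrable_of_continuous_unitaryGroup μ (by fun_prop))
    (integrable_of_continuous_unitaryGroup μ (by fun_prop))] at h
  simp only [integral_const_mul] at h
  linear_combination h / 1152

lemma integral_expect_pow_four_rotation (ψ : ι → ℂ) {P C : Matrix ι ι ℂ} (hP : Pᴴ = P)
    (hC : Cᴴ = C) (hPP : P * P = 1) (hCC : C * C = 1) (hCP : C * P = -(P * C)) :
    169344 * ∫ U, expect ψ P U ^ 2 * expect ψ C U ^ 2 ∂μ + 331776 * ∫ U, expect ψ C U ^ 4 ∂μ =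
      388224 * ∫ U, expect ψ P U ^ 4 ∂μ := by
  have cP := continuous_expect ψ P
  have cC := continuous_expect ψ C
  have h := integral_expect_rotation_add μ ψ hP hC hPP hCC hCP 4
  have hpt (p c : ℂ) : (7 * p + 24 * c) ^ 4 + (7 * p - 24 * c) ^ 4 =
      4802 * p ^ 4 + 338688 * (p ^ 2 * c ^ 2) + 663552 * c ^ 4 := by
    ring
  simp only [hpt, mul_pow] at h
  rw [integral_add (integrable_of_continuous_unitaryGroup μ (by fun_prop))
    (integrable_of_continuous_unitaryGroup μ (by fun_prop)),
    integral_add (integrable_of_continuous_unitaryGroup μ (by fun_prop))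
    (integrable_of_continuous_unitaryGroup μ (by fun_prop))] at h
  simp only [integral_const_mul] at h
  linear_combination h / 2

lemma integral_expect_sq_mul_sq_of_anticommute (ψ : ι → ℂ) {P C : Matrix ι ι ℂ} (hP : Pᴴ = P)
    (hC : Cᴴ = C) (hPP : P * P = 1) (hCC : C * C = 1) (hCP : C * P = -(P * C)) :
    3 * ∫ U, expect ψ P U ^ 2 * expect ψ C U ^ 2 ∂μ = ∫ U, expect ψ P U ^ 4 ∂μ := by
  have h1 := integral_expect_pow_four_rotation μ ψ hP hC hPP hCC hCP
  have h2 := integral_expect_pow_four_rotation μ ψ hC hP hCC hPP (by rw [hCP, neg_neg])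
  simp only [mul_comm (expect ψ C _ ^ 2)] at h2
  linear_combination (388224 * h1 + 331776 * h2) / (720000 * 56448)

end Expectation

lemma pauliString_anticommute {n : ℕ} {f g : Fin n → Fin 4} (h : pauliStringSign f g = -1) :
    pauliString g * pauliString f = -(pauliString f * pauliString g) := by
  have h1 := congrArg (fun M => pauliString f * M) (pauliString_mul_mul f g)
  simp only [h, ← Matrix.mul_assoc, pauliString_mul_self, Matrix.one_mul] at h1
  simpa using h1

lemma sum_one_sub_pauliStringSign {n : ℕ} {f : Fin n → Fin 4} (hf : f ≠ 0) :
    ∑ g, (1 - pauliStringSign f g) = ((2 : ℂ) ^ n) ^ 2 := by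
  rw [Finset.sum_sub_distrib, sum_pauliStringSign hf, ← pow_mul, mul_comm, pow_mul]
  norm_num

section PauliMoments

variable {n : ℕ} {ψ : (Fin n → Fin 2) → ℂ} {f : Fin n → Fin 4}
  (μ : Measure (Matrix.unitaryGroup (Fin n → Fin 2) ℂ)) [μ.IsHaarMeasure]

lemma sum_one_sub_pauliStringSign_mul_expect_sq (hψ : star ψ ⬝ᵥ ψ = 1)
    (U : Matrix.unitaryGroup (Fin n → Fin 2) ℂ) :
    ∑ g, (1 - pauliStringSign f g) * expect ψ (pauliString g) U ^ 2 =
      2 ^ n * (1 - expect ψ (pauliString f) U ^ 2) := by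
  simp only [sub_mul, one_mul, Finset.sum_sub_distrib, expect, sum_pauliStringSign_mul_trace_sq,
    sum_trace_pauliString_sq (star_unitary_mulVec_dotProduct hψ U), mul_sub, mul_one]

lemma integral_expect_pauliString_sq [IsProbabilityMeasure μ] (hψ : star ψ ⬝ᵥ ψ = 1)
    (hf : f ≠ 0) :
    ((2 : ℂ) ^ n + 1) * ∫ U, expect ψ (pauliString f) U ^ 2 ∂μ = 1 := by
  have c (g : Fin n → Fin 4) := continuous_expect ψ (pauliString g)
  have h : ((2 : ℂ) ^ n) ^ 2 * ∫ U, expect ψ (pauliString f) U ^ 2 ∂μ =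
      ∫ U, 2 ^ n * (1 - expect ψ (pauliString f) U ^ 2) ∂μ := by
    simp only [← sum_one_sub_pauliStringSign_mul_expect_sq (f := f) hψ]
    rw [integral_finsetSum _ fun g _ => integrable_of_continuous_unitaryGroup μ (by fun_prop),
      ← sum_one_sub_pauliStringSign hf, Finset.sum_mul]
    refine Finset.sum_congr rfl fun g _ => ?_
    rw [integral_const_mul]
    rcases pauliStringSign_eq f g with hg | hg
    · simp [hg]
    · rw [integral_expect_sq_of_anticommute μ ψ (pauliString_conjTranspose f)
        (pauliString_conjTranspose g) (pauliString_mul_self f) (pauliString_mul_self g)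
        (pauliString_anticommute hg)]
  rw [integral_const_mul, integral_sub (integrable_const _)
    (integrable_of_continuous_unitaryGroup μ (by fun_prop))] at h
  simp only [integral_const, probReal_univ, one_smul] at h
  have h2 : (2 : ℂ) ^ n ≠ 0 := pow_ne_zero _ two_ne_zero
  apply mul_left_cancel₀ h2
  linear_combination h

lemma integral_expect_pauliString_pow_four [IsProbabilityMeasure μ] (hψ : star ψ ⬝ᵥ ψ = 1)
    (hf : f ≠ 0) :
    ((2 : ℂ) ^ n + 1) * ((2 : ℂ) ^ n + 3) * ∫ U, expect ψ (pauliString f) U ^ 4 ∂μ = 3 := by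
  have c (g : Fin n → Fin 4) := continuous_expect ψ (pauliString g)
  have h : ((2 : ℂ) ^ n) ^ 2 * ∫ U, expect ψ (pauliString f) U ^ 4 ∂μ =
      3 * ∫ U, expect ψ (pauliString f) U ^ 2 *
        (2 ^ n * (1 - expect ψ (pauliString f) U ^ 2)) ∂μ := by
    simp only [← sum_one_sub_pauliStringSign_mul_expect_sq (f := f) hψ, Finset.mul_sum,
      mul_left_comm (expect ψ (pauliString f) _ ^ 2)]
    rw [integral_finsetSum _ fun g _ => integrable_of_continuous_unitaryGroup μ (by fun_prop),
      ← sum_one_sub_pauliStringSign hf, Finset.sum_mul, Finset.mul_sum]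
    refine Finset.sum_congr rfl fun g _ => ?_
    rw [integral_const_mul]
    rcases pauliStringSign_eq f g with hg | hg
    · simp [hg]
    · rw [← integral_expect_sq_mul_sq_of_anticommute μ ψ (pauliString_conjTranspose f)
        (pauliString_conjTranspose g) (pauliString_mul_self f) (pauliString_mul_self g)
        (pauliString_anticommute hg)]
      ring
  have hpt (p : ℂ) : p ^ 2 * (2 ^ n * (1 - p ^ 2)) = 2 ^ n * (p ^ 2 - p ^ 4) := by ring
  simp only [hpt] at h
  rw [integral_const_mul, integral_sub (integrable_of_continuous_unitaryGroup μ (by fun_prop))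
    (integrable_of_continuous_unitaryGroup μ (by fun_prop))] at h
  have h2 : (2 : ℂ) ^ n ≠ 0 := pow_ne_zero _ two_ne_zero
  apply mul_left_cancel₀ h2
  linear_combination ((2 : ℂ) ^ n + 1) * h +
    3 * (2 : ℂ) ^ n * integral_expect_pauliString_sq (f := f) μ hψ hf

end PauliMoments

/-- `Σ_{π ∈ S₄} tr(Q T_π) = 4d² + 12d + 8` with `d = 2ⁿ`, and consequently
the Haar average of `tr(Q (Uψψ†U†)^{⊗4})` over `U(d)` equals
`(4d² + 12d + 8)/(d(d+1)(d+2)(d+3))` for any unit vector `ψ`. -/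
theorem trace_Q_perm_sum_and_haar_average
    (n : ℕ) (hn : 1 ≤ n) (ψ : (Fin n → Fin 2) → ℂ) (hψ : star ψ ⬝ᵥ ψ = 1)
    (μ : Measure (Matrix.unitaryGroup (Fin n → Fin 2) ℂ)) [μ.IsHaarMeasure]
    [IsProbabilityMeasure μ] :
    (∑ π : Equiv.Perm (Fin 4), ((Qop n) * permOp 4 π).trace =
        4 * ((2 : ℂ) ^ n) ^ 2 + 12 * ((2 : ℂ) ^ n) + 8) ∧
    (∫ U : Matrix.unitaryGroup (Fin n → Fin 2) ℂ,
        ((Qop n) * kronPow 4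
          (pureState ((U : Matrix (Fin n → Fin 2) (Fin n → Fin 2) ℂ).mulVec ψ))).trace ∂μ) =
      (4 * ((2 : ℂ) ^ n) ^ 2 + 12 * ((2 : ℂ) ^ n) + 8) /
        (((2 : ℂ) ^ n) * ((2 : ℂ) ^ n + 1) * ((2 : ℂ) ^ n + 2) * ((2 : ℂ) ^ n + 3)) := by
  refine ⟨sum_trace_Qop_mul_permOp n, ?_⟩
  have h (U : Matrix.unitaryGroup (Fin n → Fin 2) ℂ) :
      (Qop n * kronPow 4
        (pureState ((U : Matrix (Fin n → Fin 2) (Fin n → Fin 2) ℂ).mulVec ψ))).trace =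
      (((2 : ℂ) ^ n) ^ 2)⁻¹ * ∑ f, expect ψ (pauliString f) U ^ 4 := by
    rw [Qop, Matrix.smul_mul, Matrix.trace_smul, Matrix.sum_mul, Matrix.trace_sum, smul_eq_mul]
    simp only [trace_kronPow_mul_kronPow, expect]
  simp only [h]
  have c (f : Fin n → Fin 4) := continuous_expect ψ (pauliString f)
  rw [integral_const_mul, integral_finsetSum _ fun f _ =>
    integrable_of_continuous_unitaryGroup μ (by fun_prop)]
  have h0 : (2 : ℂ) ^ n ≠ 0 := pow_ne_zero _ two_ne_zero
  have hpos (k : ℕ) : (2 : ℂ) ^ n + k ≠ 0 := by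
    exact_mod_cast (by positivity : 2 ^ n + k ≠ 0)
  have h1 : (2 : ℂ) ^ n + 1 ≠ 0 := by simpa using hpos 1
  have h2 : (2 : ℂ) ^ n + 2 ≠ 0 := by simpa using hpos 2
  have h3 : (2 : ℂ) ^ n + 3 ≠ 0 := by simpa using hpos 3
  have hne : ∀ f ∈ Finset.univ.erase (0 : Fin n → Fin 4),
      ∫ U, expect ψ (pauliString f) U ^ 4 ∂μ = 3 / (((2 : ℂ) ^ n + 1) * ((2 : ℂ) ^ n + 3)) := by
    intro f hf
    rw [eq_div_iff (mul_ne_zero h1 h3), mul_comm]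
    exact integral_expect_pauliString_pow_four μ hψ (Finset.ne_of_mem_erase hf)
  have hcard : (((Finset.univ.erase (0 : Fin n → Fin 4)).card : ℕ) : ℂ) =
      ((2 : ℂ) ^ n) ^ 2 - 1 := by
    rw [Finset.cast_card_erase_of_mem (Finset.mem_univ _), ← pow_mul, mul_comm, pow_mul]
    norm_num
  rw [← Finset.add_sum_erase _ _ (Finset.mem_univ (0 : Fin n → Fin 4)), Finset.sum_congr rfl hne,
    Finset.sum_const, nsmul_eq_mul, hcard]
  simp only [pauliString_zero, expect_one hψ, one_pow, integral_const, probReal_univ, one_smul]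
  field_simp
  ring
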